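/- Let 0 < c ≤ 1 and let f₂(z) = z·exp(∫₀^z (√(1 − ct) − 1)/t dt). Then f₂ ∈ S*(q_c) and its pre-Schwarzian norm satisfies ||P_{f₂}|| = c(1 − α²)/(2(1 − cα)) + (1 − α²)(1 − √(1 − cα))/α, where α is the unique root in (0,1) of the equation −2 + 4cr − (2 + c²)r² + 2cr³ − c²r⁴ + (1 − cr)^{3/2}(2 − cr + 2r² − 3cr³) = 0. In particular, the bound of the norm estimate for S*(q_c) is sharp. -/

import Mathlib

open Metric Set

noncomputable section

/-- The open unit disk in the complex plane. -/
def unitDisk : Set ℂ := Metric.ball 0 1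

/-- A function is normalized if it is analytic on the unit disk with f(0)=0 and f'(0)=1. -/
def IsNormalized (f : ℂ → ℂ) : Prop :=
  AnalyticOnNhd ℂ f unitDisk ∧ f 0 = 0 ∧ deriv f 0 = 1

/-- Subordination: f ≺ g on the unit disk. -/
def Subord (f g : ℂ → ℂ) : Prop :=
  ∃ ω : ℂ → ℂ, AnalyticOnNhd ℂ ω unitDisk ∧ ω 0 = 0 ∧
    Set.MapsTo ω unitDisk unitDisk ∧ Set.EqOn f (g ∘ ω) unitDisk

/-- The quantity z f'(z)/f(z), extended by its analytic value 1 at z = 0. -/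
def sratio (f : ℂ → ℂ) (z : ℂ) : ℂ := if z = 0 then 1 else z * deriv f z / f z

/-- The Ma-Minda starlike class S*(φ). -/
def MemSstar (φ f : ℂ → ℂ) : Prop :=
  IsNormalized f ∧ (∀ z ∈ unitDisk, z ≠ 0 → f z ≠ 0) ∧ Subord (sratio f) φ

/-- The Ma-Minda convex class C(φ). -/
def MemC (φ g : ℂ → ℂ) : Prop :=
  IsNormalized g ∧ (∀ z ∈ unitDisk, deriv g z ≠ 0) ∧
    Subord (fun z => 1 + z * deriv (deriv g) z / deriv g z) φ

/-- The set of values (1-|z|²)|P_f(z)|, z ∈ 𝔻, whose supremum is the pre-Schwarzian norm. -/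
def pSVals (f : ℂ → ℂ) : Set ℝ :=
  {x : ℝ | ∃ z ∈ unitDisk, x = (1 - ‖z‖^2) * ‖deriv (deriv f) z / deriv f z‖}

/-- The integrand (√(1 − ct) − 1)/t, extended by its analytic value −c/2 at t = 0,
where √ is the principal branch of the square root. -/
def sqrtIntegrand (c : ℝ) (t : ℂ) : ℂ :=
  if t = 0 then -((c:ℂ)/2) else ((1 - (c:ℂ) * t) ^ ((1:ℂ)/2) - 1) / t

/-- The extremal function f₂(z) = z·exp(∫₀^z (√(1 − ct) − 1)/t dt), the integral being
taken along the segment from 0 to z. -/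
def extremalSstarQc (c : ℝ) (z : ℂ) : ℂ :=
  z * Complex.exp (z * ∫ s in (0:ℝ)..1, sqrtIntegrand c ((s:ℂ) * z))

/-- The function `t ↦ √(1 - c * t)` on the unit disk, with its principal branch. -/
def sqrtOneSub (c : ℝ) (z : ℂ) : ℂ := (1 - (c : ℂ) * z) ^ ((1 : ℂ) / 2)

section SqrtOneSub

variable {c : ℝ} {z : ℂ}

lemma mul_norm_lt_one (hc₀ : 0 < c) (hc₁ : c ≤ 1) (hz : z ∈ unitDisk) : c * ‖z‖ < 1 := by
  have hz' : ‖z‖ < 1 := by simpa [unitDisk] using hz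
  nlinarith

lemma one_sub_mul_norm_le_re (hc₀ : 0 < c) : 1 - c * ‖z‖ ≤ (1 - (c : ℂ) * z).re := by
  have := Complex.re_le_norm z
  simp only [Complex.sub_re, Complex.one_re, Complex.re_ofReal_mul]
  nlinarith

lemma one_sub_mul_mem_slitPlane (hc₀ : 0 < c) (hc₁ : c ≤ 1) (hz : z ∈ unitDisk) :
    1 - (c : ℂ) * z ∈ Complex.slitPlane :=
  Or.inl <| lt_of_lt_of_le (sub_pos.2 (mul_norm_lt_one hc₀ hc₁ hz)) (one_sub_mul_norm_le_re hc₀)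

lemma sqrtOneSub_sq (c : ℝ) (z : ℂ) : sqrtOneSub c z ^ 2 = 1 - (c : ℂ) * z := by
  rw [sqrtOneSub, one_div]
  exact_mod_cast Complex.cpow_nat_inv_pow (1 - (c : ℂ) * z) two_ne_zero

lemma sqrt_le_re_sqrtOneSub (hc₀ : 0 < c) (z : ℂ) :
    √(1 - c * ‖z‖) ≤ (sqrtOneSub c z).re := by
  rw [sqrtOneSub, one_div, Complex.cpow_inv_two_re]
  apply Real.sqrt_le_sqrt
  have h₁ := one_sub_mul_norm_le_re (z := z) hc₀
  have h₂ := Complex.re_le_norm (1 - (c : ℂ) * z)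
  linarith

lemma sqrtOneSub_ne_zero (hc₀ : 0 < c) (hc₁ : c ≤ 1) (hz : z ∈ unitDisk) :
    sqrtOneSub c z ≠ 0 := by
  have h := sqrtOneSub_sq c z
  intro h0
  rw [h0] at h
  exact Complex.slitPlane_ne_zero (one_sub_mul_mem_slitPlane hc₀ hc₁ hz) (by simpa using h.symm)

lemma one_add_sqrtOneSub_ne_zero (hc₀ : 0 < c) (z : ℂ) : 1 + sqrtOneSub c z ≠ 0 := by
  intro h0
  have h := congrArg Complex.re h0
  have := sqrt_le_re_sqrtOneSub hc₀ z
  have := Real.sqrt_nonneg (1 - c * ‖z‖)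
  simp only [Complex.add_re, Complex.one_re, Complex.zero_re] at h
  linarith

lemma hasDerivAt_sqrtOneSub (hc₀ : 0 < c) (hc₁ : c ≤ 1) (hz : z ∈ unitDisk) :
    HasDerivAt (sqrtOneSub c) (-(c : ℂ) / (2 * sqrtOneSub c z)) z := by
  have hs := one_sub_mul_mem_slitPlane hc₀ hc₁ hz
  have h₀ : HasDerivAt (fun z : ℂ => 1 - (c : ℂ) * z) (-(c : ℂ)) z := by
    simpa using ((hasDerivAt_id z).const_mul (c : ℂ)).const_sub 1
  have h := h₀.cpow_const (c := (1 : ℂ) / 2) hs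
  have hne := sqrtOneSub_ne_zero hc₀ hc₁ hz
  refine HasDerivAt.congr_deriv (f := sqrtOneSub c) h ?_
  rw [Complex.cpow_sub _ _ (Complex.slitPlane_ne_zero hs), Complex.cpow_one]
  change 1 / 2 * (sqrtOneSub c z / (1 - (c : ℂ) * z)) * -(c : ℂ) = _
  rw [← sqrtOneSub_sq c z]
  field_simp

lemma sqrtIntegrand_eq (hc₀ : 0 < c) (z : ℂ) :
    sqrtIntegrand c z = -(c : ℂ) / (1 + sqrtOneSub c z) := by
  have hne := one_add_sqrtOneSub_ne_zero hc₀ z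
  unfold sqrtIntegrand
  split_ifs with hz
  · subst hz
    have h1 : sqrtOneSub c 0 = 1 := by simp [sqrtOneSub]
    rw [h1]
    ring
  · change (sqrtOneSub c z - 1) / z = _
    have h := sqrtOneSub_sq c z
    rw [div_eq_div_iff hz hne]
    linear_combination h

lemma one_add_mul_sqrtIntegrand (c : ℝ) (z : ℂ) :
    1 + z * sqrtIntegrand c z = sqrtOneSub c z := by
  unfold sqrtIntegrand
  split_ifs with hz
  · simp [hz, sqrtOneSub]
  · rw [mul_div_cancel₀ _ hz, sqrtOneSub]
    ring

lemma differentiableOn_sqrtIntegrand (hc₀ : 0 < c) (hc₁ : c ≤ 1) :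
    DifferentiableOn ℂ (sqrtIntegrand c) unitDisk := by
  rw [show sqrtIntegrand c = fun z => -(c : ℂ) / (1 + sqrtOneSub c z) from
    funext (sqrtIntegrand_eq hc₀)]
  intro z hz
  exact ((differentiableAt_const _).div
    ((differentiableAt_const _).add (hasDerivAt_sqrtOneSub hc₀ hc₁ hz).differentiableAt)
    (one_add_sqrtOneSub_ne_zero hc₀ z)).differentiableWithinAt

end SqrtOneSub

/-- The integral along the segment from `0` of a holomorphic function on the unit disk is a
primitive of that function. -/
lemma hasDerivAt_mul_integral_segment {g : ℂ → ℂ} (hg : DifferentiableOn ℂ g unitDisk) {z : ℂ}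
    (hz : z ∈ unitDisk) :
    HasDerivAt (fun z : ℂ => z * ∫ s in (0 : ℝ)..1, g ((s : ℂ) * z)) (g z) z := by
  obtain ⟨G, hG⟩ : Complex.IsExactOn g unitDisk := DifferentiableOn.isExactOn_ball hg
  have hopen : IsOpen unitDisk := isOpen_ball
  refine ((hG z hz).sub_const (G 0)).congr_of_eventuallyEq ?_
  filter_upwards [hopen.mem_nhds hz] with w hw
  have hmem : ∀ s ∈ uIcc (0 : ℝ) 1, (s : ℂ) * w ∈ unitDisk := by
    intro s hs
    rw [uIcc_of_le zero_le_one] at hs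
    have hw' : ‖w‖ < 1 := by simpa [unitDisk] using hw
    have : ‖(s : ℂ) * w‖ < 1 := by
      rw [norm_mul, Complex.norm_real, Real.norm_of_nonneg hs.1]
      nlinarith [hs.1, hs.2, norm_nonneg w]
    simpa [unitDisk] using this
  have hd : ∀ s ∈ uIcc (0 : ℝ) 1,
      HasDerivAt (fun s : ℝ => G ((s : ℂ) * w)) (w * g ((s : ℂ) * w)) s := by
    intro s hs
    have h1 : HasDerivAt (fun s : ℝ => (s : ℂ) * w) w s := by
      simpa using (Complex.ofRealCLM.hasDerivAt (x := s)).mul_const w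
    have h2 := (hG _ (hmem s hs)).comp s h1
    simpa [mul_comm, Function.comp_def] using h2
  have hcont : ContinuousOn (fun s : ℝ => w * g ((s : ℂ) * w)) (uIcc 0 1) :=
    continuousOn_const.mul (hg.continuousOn.comp (by fun_prop) hmem)
  have h := intervalIntegral.integral_eq_sub_of_hasDerivAt hd hcont.intervalIntegrable
  rw [intervalIntegral.integral_const_mul] at h
  simpa using h

section Extremal

variable {c : ℝ} {z : ℂ}

/-- The exponential factor of the extremal function. -/
def extremalFactor (c : ℝ) (z : ℂ) : ℂ :=
  Complex.exp (z * ∫ s in (0 : ℝ)..1, sqrtIntegrand c ((s : ℂ) * z))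

lemma hasDerivAt_extremalFactor (hc₀ : 0 < c) (hc₁ : c ≤ 1) (hz : z ∈ unitDisk) :
    HasDerivAt (extremalFactor c) (extremalFactor c z * sqrtIntegrand c z) z :=
  (hasDerivAt_mul_integral_segment (differentiableOn_sqrtIntegrand hc₀ hc₁) hz).cexp

lemma hasDerivAt_extremalSstarQc (hc₀ : 0 < c) (hc₁ : c ≤ 1) (hz : z ∈ unitDisk) :
    HasDerivAt (extremalSstarQc c) (extremalFactor c z * sqrtOneSub c z) z := by
  have h := (hasDerivAt_id z).mul (hasDerivAt_extremalFactor hc₀ hc₁ hz)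
  refine HasDerivAt.congr_deriv (f := extremalSstarQc c) h ?_
  rw [← one_add_mul_sqrtIntegrand, id]
  ring

lemma deriv_deriv_extremalSstarQc_div (hc₀ : 0 < c) (hc₁ : c ≤ 1) (hz : z ∈ unitDisk) :
    deriv (deriv (extremalSstarQc c)) z / deriv (extremalSstarQc c) z =
      -(c / (1 + sqrtOneSub c z) + c / (2 * sqrtOneSub c z ^ 2)) := by
  have hopen : IsOpen unitDisk := isOpen_ball
  have hE : extremalFactor c z ≠ 0 := Complex.exp_ne_zero _
  have hS := sqrtOneSub_ne_zero hc₀ hc₁ hz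
  have hS' := one_add_sqrtOneSub_ne_zero hc₀ z
  have hev : deriv (extremalSstarQc c) =ᶠ[nhds z]
      fun w => extremalFactor c w * sqrtOneSub c w := by
    filter_upwards [hopen.mem_nhds hz] with w hw
    exact (hasDerivAt_extremalSstarQc hc₀ hc₁ hw).deriv
  have h2 := (hasDerivAt_extremalFactor hc₀ hc₁ hz).fun_mul (hasDerivAt_sqrtOneSub hc₀ hc₁ hz)
  rw [hev.deriv_eq, hev.eq_of_nhds, h2.deriv, sqrtIntegrand_eq hc₀]
  field_simp
  ring

lemma memSstar_extremalSstarQc (hc₀ : 0 < c) (hc₁ : c ≤ 1) :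
    MemSstar (fun z => (1 + (c : ℂ) * z) ^ ((1 : ℂ) / 2)) (extremalSstarQc c) := by
  have hopen : IsOpen unitDisk := isOpen_ball
  have h0 : (0 : ℂ) ∈ unitDisk := by simp [unitDisk]
  refine ⟨⟨?_, by simp [extremalSstarQc], ?_⟩, ?_, ?_⟩
  · exact DifferentiableOn.analyticOnNhd (fun z hz =>
      (hasDerivAt_extremalSstarQc hc₀ hc₁ hz).differentiableAt.differentiableWithinAt) hopen
  · rw [(hasDerivAt_extremalSstarQc hc₀ hc₁ h0).deriv]
    simp [extremalFactor, sqrtOneSub]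
  · exact fun z _ hz => mul_ne_zero hz (Complex.exp_ne_zero _)
  · refine ⟨fun z => -z, fun z _ => analyticAt_id.neg, neg_zero, fun z hz => ?_, fun z hz => ?_⟩
    · simpa [unitDisk] using hz
    · have hS : ((fun z => (1 + (c : ℂ) * z) ^ ((1 : ℂ) / 2)) ∘ fun z => -z) z =
          sqrtOneSub c z := by
        simp [sqrtOneSub, sub_eq_add_neg]
      rw [hS, sratio]
      split_ifs with hz0
      · simp [hz0, sqrtOneSub]
      · have hE : extremalFactor c z ≠ 0 := Complex.exp_ne_zero _
        rw [(hasDerivAt_extremalSstarQc hc₀ hc₁ hz).deriv,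
          show extremalSstarQc c z = z * extremalFactor c z from rfl]
        field_simp

lemma norm_deriv_deriv_extremalSstarQc_div_le (hc₀ : 0 < c) (hc₁ : c ≤ 1) (hz : z ∈ unitDisk) :
    ‖deriv (deriv (extremalSstarQc c)) z / deriv (extremalSstarQc c) z‖ ≤
      c / (1 + √(1 - c * ‖z‖)) + c / (2 * √(1 - c * ‖z‖) ^ 2) := by
  have hpos : 0 < 1 - c * ‖z‖ := sub_pos.2 (mul_norm_lt_one hc₀ hc₁ hz)
  have hre := sqrt_le_re_sqrtOneSub hc₀ z
  have hspos : 0 < √(1 - c * ‖z‖) := Real.sqrt_pos.2 hpos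
  rw [deriv_deriv_extremalSstarQc_div hc₀ hc₁ hz, norm_neg]
  refine (norm_add_le _ _).trans ?_
  simp only [norm_div, norm_mul, norm_pow, Complex.norm_real, Real.norm_of_nonneg hc₀.le,
    Complex.norm_ofNat]
  have h1 : 1 + √(1 - c * ‖z‖) ≤ ‖1 + sqrtOneSub c z‖ := by
    refine le_trans ?_ (Complex.re_le_norm _)
    simpa using hre
  have h2 : √(1 - c * ‖z‖) ≤ ‖sqrtOneSub c z‖ := hre.trans (Complex.re_le_norm _)
  gcongr

lemma sqrtOneSub_ofReal {r : ℝ} (hr : 0 ≤ 1 - c * r) :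
    sqrtOneSub c r = (√(1 - c * r) : ℝ) := by
  rw [sqrtOneSub, Real.sqrt_eq_rpow, Complex.ofReal_cpow hr]
  push_cast
  rfl

lemma norm_deriv_deriv_extremalSstarQc_div_ofReal (hc₀ : 0 < c) (hc₁ : c ≤ 1) {r : ℝ}
    (hr : (r : ℂ) ∈ unitDisk) (hr' : 0 ≤ 1 - c * r) :
    ‖deriv (deriv (extremalSstarQc c)) r / deriv (extremalSstarQc c) r‖ =
      c / (1 + √(1 - c * r)) + c / (2 * √(1 - c * r) ^ 2) := by
  rw [deriv_deriv_extremalSstarQc_div hc₀ hc₁ hr, norm_neg, sqrtOneSub_ofReal hr']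
  have : ((c : ℂ) / (1 + (√(1 - c * r) : ℝ)) + c / (2 * ((√(1 - c * r) : ℝ) : ℂ) ^ 2)) =
      ((c / (1 + √(1 - c * r)) + c / (2 * √(1 - c * r) ^ 2) : ℝ) : ℂ) := by
    push_cast
    rfl
  rw [this, Complex.norm_real, Real.norm_of_nonneg (by positivity)]

end Extremal

section Profile

/-- Up to the factor `1 / (2 * c)`, the radial profile of the pre-Schwarzian derivative in the
variable `t = √(1 - c * r)`. -/
def radialProfile (c t : ℝ) : ℝ :=
  c ^ 2 * (2 / (1 + t) + 1 / t ^ 2) - (1 / t ^ 2 - 2 * t - t ^ 2 + 2 * t ^ 3)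

/-- Up to the factor `2 * t`, the derivative of `radialProfile c`. -/
def radialSlope (c t : ℝ) : ℝ :=
  (1 - c ^ 2) * (1 / t ^ 4 + 1 / t) + c ^ 2 * (1 / (1 + t) + 1 / (1 + t) ^ 2) + 1 - 3 * t

variable {c : ℝ}

lemma radialProfile_eq (hc : c ≠ 0) {r t : ℝ} (ht : 0 < t) (hrt : t ^ 2 = 1 - c * r) :
    (1 - r ^ 2) * (c / (1 + t) + c / (2 * t ^ 2)) = radialProfile c t / (2 * c) := by
  have hr : r = (1 - t ^ 2) / c := by
    field_simp
    linarith
  have h1 : 1 + t ≠ 0 := by positivity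
  rw [hr, radialProfile]
  field_simp
  ring

lemma hasDerivAt_radialProfile {t : ℝ} (ht : 0 < t) :
    HasDerivAt (radialProfile c) (2 * t * radialSlope c t) t := by
  have h1 : 1 + t ≠ 0 := by positivity
  have h2 : t ^ 2 ≠ 0 := by positivity
  have hid := hasDerivAt_id t
  have ha := (hasDerivAt_const t (2 : ℝ)).div (hid.const_add 1) h1
  have hb := (hasDerivAt_const t (1 : ℝ)).div (hasDerivAt_pow 2 t) h2
  have h := ((ha.add hb).const_mul (c ^ 2)).sub
    (((hb.sub (hid.const_mul 2)).sub (hasDerivAt_pow 2 t)).add ((hasDerivAt_pow 3 t).const_mul 2))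
  refine HasDerivAt.congr_deriv (f := radialProfile c) h ?_
  simp only [radialSlope, id]
  field_simp
  ring

lemma radialSlope_antitone (hc₀ : 0 < c) (hc₁ : c ≤ 1) {s t : ℝ} (hs : 0 < s) (hst : s ≤ t) :
    radialSlope c t ≤ radialSlope c s := by
  have : 0 ≤ 1 - c ^ 2 := by nlinarith
  unfold radialSlope
  have h : (1 - c ^ 2) * (1 / t ^ 4 + 1 / t) + c ^ 2 * (1 / (1 + t) + 1 / (1 + t) ^ 2) ≤
      (1 - c ^ 2) * (1 / s ^ 4 + 1 / s) + c ^ 2 * (1 / (1 + s) + 1 / (1 + s) ^ 2) := by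
    gcongr
  linarith

lemma radialProfile_le_of_radialSlope_eq_zero (hc₀ : 0 < c) (hc₁ : c ≤ 1) {s t : ℝ}
    (hs : 0 < s) (hslope : radialSlope c s = 0) (ht : 0 < t) :
    radialProfile c t ≤ radialProfile c s := by
  have hcont : ∀ D : Set ℝ, D ⊆ Ioi 0 → ContinuousOn (radialProfile c) D := fun D hD x hx =>
    (hasDerivAt_radialProfile (hD hx)).continuousAt.continuousWithinAt
  have hdiff : ∀ D : Set ℝ, D ⊆ Ioi 0 → DifferentiableOn ℝ (radialProfile c) D := fun D hD x hx =>
    (hasDerivAt_radialProfile (hD hx)).differentiableAt.differentiableWithinAt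
  rcases le_total t s with hts | hts
  · have hsub : Icc t s ⊆ Ioi 0 := fun x hx => ht.trans_le hx.1
    refine monotoneOn_of_deriv_nonneg (convex_Icc t s) (hcont _ hsub)
      (hdiff _ (interior_subset.trans hsub)) (fun x hx => ?_) (left_mem_Icc.2 hts)
      (right_mem_Icc.2 hts) hts
    have hx' := interior_subset hx
    have hx0 : 0 < x := hsub hx'
    rw [(hasDerivAt_radialProfile hx0).deriv]
    have := radialSlope_antitone hc₀ hc₁ hx0 hx'.2
    rw [hslope] at this
    positivity
  · have hsub : Icc s t ⊆ Ioi 0 := fun x hx => hs.trans_le hx.1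
    refine antitoneOn_of_deriv_nonpos (convex_Icc s t) (hcont _ hsub)
      (hdiff _ (interior_subset.trans hsub)) (fun x hx => ?_) (left_mem_Icc.2 hts)
      (right_mem_Icc.2 hts) hts
    have hx' := interior_subset hx
    have hx0 : 0 < x := hsub hx'
    rw [(hasDerivAt_radialProfile hx0).deriv]
    have := radialSlope_antitone hc₀ hc₁ hs hx'.1
    rw [hslope] at this
    exact mul_nonpos_of_nonneg_of_nonpos (by positivity) this

lemma radialSlope_eq_zero (hc : c ≠ 0) {α s : ℝ} (hs : 0 < s) (hs1 : s ≠ 1)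
    (hαs : s ^ 2 = 1 - c * α)
    (hroot : -2 + 4 * c * α - (2 + c ^ 2) * α ^ 2 + 2 * c * α ^ 3 - c ^ 2 * α ^ 4 +
      s ^ 3 * (2 - c * α + 2 * α ^ 2 - 3 * c * α ^ 3) = 0) :
    radialSlope c s = 0 := by
  have hα : α = (1 - s ^ 2) / c := by
    field_simp
    linarith
  have hs1' : (1 - s) ^ 2 ≠ 0 := pow_ne_zero 2 (sub_ne_zero.2 hs1.symm)
  have hcrit : c ^ 2 * ((1 + s) ^ 2 + s ^ 3) -
      (1 + s ^ 3 + s ^ 4 - 3 * s ^ 5) * (1 + s) ^ 2 = 0 := by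
    refine (mul_eq_zero.1 (?_ : (1 - s) ^ 2 * _ = 0)).resolve_left hs1'
    rw [hα] at hroot
    field_simp at hroot
    linear_combination hroot
  have h1 : 1 + s ≠ 0 := by positivity
  rw [radialSlope]
  field_simp
  linear_combination -hcrit

end Profile

/-- Sharpness of the pre-Schwarzian norm estimate for S*(q_c): the extremal function f₂
belongs to S*(q_c) and its pre-Schwarzian norm equals the bound. -/
theorem preSchwarzian_sharp_Sstar_qc (c : ℝ) (hc₀ : 0 < c) (hc₁ : c ≤ 1)
    (α : ℝ) (hα : α ∈ Set.Ioo (0:ℝ) 1)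
    (hroot : -2 + 4*c*α - (2 + c^2)*α^2 + 2*c*α^3 - c^2*α^4 +
      (1 - c*α) ^ ((3:ℝ)/2) * (2 - c*α + 2*α^2 - 3*c*α^3) = 0) :
    MemSstar (fun z => (1 + (c:ℂ) * z) ^ ((1:ℂ)/2)) (extremalSstarQc c) ∧
      IsLUB (pSVals (extremalSstarQc c))
        (c * (1 - α^2) / (2 * (1 - c*α)) + (1 - α^2) * (1 - Real.sqrt (1 - c*α)) / α) := by
  refine ⟨memSstar_extremalSstarQc hc₀ hc₁, ?_⟩
  obtain ⟨hα0, hα1⟩ := hα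
  have hpos : 0 < 1 - c * α := by nlinarith
  have hs : 0 < √(1 - c * α) := Real.sqrt_pos.2 hpos
  have hs2 : √(1 - c * α) ^ 2 = 1 - c * α := Real.sq_sqrt hpos.le
  have hs1 : √(1 - c * α) ≠ 1 := by
    intro h
    rw [h] at hs2
    nlinarith [mul_pos hc₀ hα0]
  have hpow : (1 - c * α) ^ ((3 : ℝ) / 2) = √(1 - c * α) ^ 3 := by
    rw [Real.sqrt_eq_rpow, ← Real.rpow_mul_natCast hpos.le]
    norm_num
  have hslope : radialSlope c √(1 - c * α) = 0 :=
    radialSlope_eq_zero hc₀.ne' hs hs1 hs2 (hpow ▸ hroot)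
  have hval : c * (1 - α ^ 2) / (2 * (1 - c * α)) + (1 - α ^ 2) * (1 - √(1 - c * α)) / α =
      (1 - α ^ 2) * (c / (1 + √(1 - c * α)) + c / (2 * √(1 - c * α) ^ 2)) := by
    have h1 : (1 - √(1 - c * α)) / α = c / (1 + √(1 - c * α)) := by
      rw [div_eq_div_iff hα0.ne' (by positivity)]
      linear_combination -hs2
    rw [mul_div_assoc (1 - α ^ 2), h1, hs2]
    ring
  rw [hval]
  have hαnorm : ‖(α : ℂ)‖ = α := by
    rw [Complex.norm_real, Real.norm_of_nonneg hα0.le]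
  have hαmem : (α : ℂ) ∈ unitDisk := by
    simpa [unitDisk, abs_of_pos hα0] using hα1
  refine IsGreatest.isLUB ⟨⟨α, hαmem, ?_⟩, ?_⟩
  · rw [norm_deriv_deriv_extremalSstarQc_div_ofReal hc₀ hc₁ hαmem hpos.le, hαnorm]
  · rintro _ ⟨z, hz, rfl⟩
    have hzpos : 0 < 1 - c * ‖z‖ := sub_pos.2 (mul_norm_lt_one hc₀ hc₁ hz)
    have hz1 : ‖z‖ < 1 := by simpa [unitDisk] using hz
    refine (mul_le_mul_of_nonneg_left (norm_deriv_deriv_extremalSstarQc_div_le hc₀ hc₁ hz)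
      (by nlinarith [norm_nonneg z])).trans ?_
    rw [radialProfile_eq hc₀.ne' (Real.sqrt_pos.2 hzpos) (Real.sq_sqrt hzpos.le),
      radialProfile_eq hc₀.ne' hs hs2]
    gcongr
    exact radialProfile_le_of_radialSlope_eq_zero hc₀ hc₁ hs hslope (Real.sqrt_pos.2 hzpos)
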